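/- Fix p₁, p₂ ∈ ℍ. For each n ∈ ℕ let Lₙ = dist(p₁, p₂ + n) and let γₙ : [0, Lₙ] → ℍ be the unit-speed geodesic segment with γₙ(0) = p₁ and γₙ(Lₙ) = p₂ + n, i.e. dist(γₙ(s), γₙ(t)) = |s−t| for s,t ∈ [0, Lₙ]. Then for every fixed t ≥ 0, γₙ(t) is defined for all sufficiently large n, and γₙ(t) converges in ℂ to the point Re(p₁) + i·Im(p₁)·e^t as n → ∞ (the point at distance t from p₁ on the upward vertical geodesic through p₁). -/

import Mathlib

open UpperHalfPlane Set Filter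

lemma aux_cosh (z w : ℍ) :
    (z.re - w.re)^2 + z.im^2 + w.im^2 = 2 * z.im * w.im * Real.cosh (dist z w) := by
  have h := UpperHalfPlane.cosh_dist' z w
  have hz := z.im_pos
  have hw := w.im_pos
  rw [h]
  field_simp

lemma aux_ratio (t : ℝ) (L : ℕ → ℝ) (hL : Tendsto L atTop atTop) :
    Tendsto (fun n => Real.cosh (L n - t) / Real.cosh (L n)) atTop (nhds (Real.exp (-t))) := by
  have e : ∀ n, Real.cosh (L n - t) / Real.cosh (L n)
      = Real.exp (-t) + Real.sinh t * (Real.exp (-(L n)) / Real.cosh (L n)) := by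
    intro n
    have hc := Real.cosh_pos (L n)
    have : Real.cosh (L n - t) = Real.exp (-t) * Real.cosh (L n)
        + Real.sinh t * Real.exp (-(L n)) := by
      rw [Real.cosh_sub, ← Real.cosh_sub_sinh, ← Real.cosh_sub_sinh]
      ring
    rw [this]
    field_simp
  simp_rw [e]
  have h0 : Tendsto (fun n => Real.exp (-(L n)) / Real.cosh (L n)) atTop (nhds 0) := by
    have h1 : Tendsto (fun n => Real.exp (-(L n))) atTop (nhds 0) :=
      Real.tendsto_exp_neg_atTop_nhds_zero.comp hL
    refine squeeze_zero (fun n => ?_) (fun n => ?_) h1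
    · have := Real.cosh_pos (L n)
      positivity
    · exact div_le_self (Real.exp_pos _).le (Real.one_le_cosh _)
  simpa using (h0.const_mul (Real.sinh t)).const_add (Real.exp (-t))

lemma aux_bdd (f : ℕ → ℝ) (K : ℝ) (h : ∀ᶠ n in atTop, |f n| ≤ K) :
    Tendsto (fun n : ℕ => f n / (n : ℝ)) atTop (nhds 0) := by
  have h1 : Tendsto (fun n : ℕ => K / (n : ℝ)) atTop (nhds 0) :=
    tendsto_const_div_atTop_nhds_zero_nat K
  refine squeeze_zero_norm' ?_ h1
  filter_upwards [h] with n hn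
  rw [Real.norm_eq_abs, abs_div, Nat.abs_cast]
  gcongr

/-- Upper half-plane counterpart of Proposition 2.2: the geodesics from `p₁` to the
horizontal translates `p₂ + n` converge, near their initial point, to the upward
vertical geodesic through `p₁`. -/
theorem geodesic_to_translates_initial_segment_tendsto_vertical
    (p₁ p₂ : ℍ) (L : ℕ → ℝ) (hL : ∀ n, L n = dist p₁ ((n : ℝ) +ᵥ p₂))
    (γ : ℕ → ℝ → ℍ)
    (hγ0 : ∀ n, γ n 0 = p₁) (hγ1 : ∀ n, γ n (L n) = (n : ℝ) +ᵥ p₂)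
    (hγ : ∀ n, ∀ s ∈ Icc (0:ℝ) (L n), ∀ t ∈ Icc (0:ℝ) (L n),
      dist (γ n s) (γ n t) = |s - t|) :
    ∀ t : ℝ, 0 ≤ t →
      (∀ᶠ n in atTop, t ∈ Icc (0:ℝ) (L n)) ∧
      Tendsto (fun n => (γ n t : ℂ)) atTop
        (nhds ((p₁.re : ℂ) + (p₁.im : ℂ) * Real.exp t * Complex.I)) := by
  intro t ht
  have hb := p₁.im_pos
  have hd := p₂.im_pos
  have hre : ∀ n : ℕ, ((n : ℝ) +ᵥ p₂).re = n + p₂.re := fun n => UpperHalfPlane.vadd_re _ _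
  have him : ∀ n : ℕ, ((n : ℝ) +ᵥ p₂).im = p₂.im := fun n => UpperHalfPlane.vadd_im _ _
  have hLtop : Tendsto L atTop atTop := by
    have h1 : Tendsto (fun n : ℕ => ((n : ℝ) - (p₁.re - p₂.re)) / p₂.im) atTop atTop :=
      (tendsto_atTop_add_const_right _ _ tendsto_natCast_atTop_atTop).atTop_div_const hd
    have h2 : Tendsto (fun n => Real.exp (L n)) atTop atTop := by
      refine tendsto_atTop_mono (fun n => ?_) h1
      have h3 := UpperHalfPlane.dist_coe_le p₁ ((n : ℝ) +ᵥ p₂)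
      rw [← hL, him, Complex.dist_eq] at h3
      have h4 := Complex.abs_re_le_norm ((p₁ : ℂ) - (((n : ℝ) +ᵥ p₂ : ℍ) : ℂ))
      rw [Complex.sub_re, UpperHalfPlane.coe_re, UpperHalfPlane.coe_re, hre] at h4
      have h5 := neg_abs_le (p₁.re - (n + p₂.re))
      rw [div_le_iff₀ hd]
      nlinarith
    simpa [Function.comp_def] using Real.tendsto_log_atTop.comp h2
  have hev : ∀ᶠ n in atTop, t ∈ Icc (0:ℝ) (L n) := by
    filter_upwards [hLtop.eventually_ge_atTop t] with n hn using ⟨ht, hn⟩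
  refine ⟨hev, ?_⟩
  have hd1 : ∀ᶠ n in atTop, dist (γ n t) p₁ = t := by
    filter_upwards [hev] with n hn
    have := hγ n t hn 0 ⟨le_rfl, hn.1.trans hn.2⟩
    rwa [hγ0, sub_zero, abs_of_nonneg ht] at this
  have hd2 : ∀ᶠ n in atTop, dist (γ n t) ((n : ℝ) +ᵥ p₂) = L n - t := by
    filter_upwards [hev] with n hn
    have := hγ n t hn (L n) ⟨hn.1.trans hn.2, le_rfl⟩
    rwa [hγ1, abs_sub_comm, abs_of_nonneg (sub_nonneg.2 hn.2)] at this
  have hy : ∀ᶠ n in atTop, |(γ n t).im| ≤ p₁.im * Real.exp t := by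
    filter_upwards [hd1] with n hn
    rw [abs_of_pos (γ n t).im_pos]
    simpa [hn] using UpperHalfPlane.im_le_im_mul_exp_dist (γ n t) p₁
  have hx : ∀ᶠ n in atTop, |(γ n t).re - p₂.re|
      ≤ p₁.im * (Real.exp t - 1) + |p₁.re - p₂.re| := by
    filter_upwards [hd1] with n hn
    have h3 := UpperHalfPlane.dist_coe_le (γ n t) p₁
    rw [hn, Complex.dist_eq] at h3
    have h4 := Complex.abs_re_le_norm ((γ n t : ℂ) - (p₁ : ℂ))
    rw [Complex.sub_re, UpperHalfPlane.coe_re, UpperHalfPlane.coe_re] at h4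
    have h5 := abs_sub_le (γ n t).re p₁.re p₂.re
    linarith
  have hu := aux_bdd _ _ hx
  have hv := aux_bdd _ _ hy
  have hc : ∀ c : ℝ, Tendsto (fun n : ℕ => c / (n : ℝ)) atTop (nhds 0) :=
    fun c => tendsto_const_div_atTop_nhds_zero_nat c
  have hnum := (((hu.sub_const 1).pow 2).add (hv.pow 2)).add ((hc p₂.im).pow 2)
  have hden := ((((hc (p₁.re - p₂.re)).sub_const 1).pow 2).add ((hc p₁.im).pow 2)).add
    ((hc p₂.im).pow 2)
  have hlim := ((hnum.div hden (by norm_num)).const_mul p₁.im).div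
    (aux_ratio t L hLtop) (Real.exp_pos _).ne'
  have hylim : Tendsto (fun n => (γ n t).im) atTop (nhds (p₁.im * Real.exp t)) := by
    have e : p₁.im * Real.exp t = p₁.im * ((((0:ℝ) - 1)^2 + 0^2 + 0^2) /
        (((0:ℝ) - 1)^2 + 0^2 + 0^2)) / Real.exp (-t) := by
      rw [Real.exp_neg]; norm_num
    rw [e]
    refine hlim.congr' ?_
    filter_upwards [hd2, eventually_gt_atTop 0] with n hn hn0
    have hn0' : (0:ℝ) < n := by exact_mod_cast hn0
    have E1 := aux_cosh (γ n t) ((n : ℝ) +ᵥ p₂)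
    have E2 := aux_cosh p₁ ((n : ℝ) +ᵥ p₂)
    rw [hn, hre, him] at E1
    rw [← hL, hre, him] at E2
    have c1 := Real.cosh_pos (L n - t)
    have c2 := Real.cosh_pos (L n)
    have F1 : (((γ n t).re - p₂.re) / (n:ℝ) - 1)^2 + ((γ n t).im / n)^2 + (p₂.im / n)^2
        = 2 * (γ n t).im * p₂.im * Real.cosh (L n - t) / n^2 := by
      rw [← E1]; field_simp; ring
    have F2 : ((p₁.re - p₂.re) / (n:ℝ) - 1)^2 + (p₁.im / n)^2 + (p₂.im / n)^2
        = 2 * p₁.im * p₂.im * Real.cosh (L n) / n^2 := by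
      rw [← E2]; field_simp; ring
    simp only [Pi.div_apply]
    rw [F1, F2]
    field_simp
  have hsq : Tendsto (fun n => ((γ n t).re - p₁.re)^2) atTop (nhds 0) := by
    have h := ((hylim.const_mul (2 * p₁.im * Real.cosh t)).sub (hylim.pow 2)).sub_const (p₁.im^2)
    have e : 2 * p₁.im * Real.cosh t * (p₁.im * Real.exp t) - (p₁.im * Real.exp t)^2 - p₁.im^2
        = 0 := by
      rw [Real.cosh_eq, Real.exp_neg]
      field_simp
      ring
    rw [e] at h
    refine h.congr' ?_
    filter_upwards [hd1] with n hn
    have E := aux_cosh (γ n t) p₁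
    rw [hn] at E
    linarith
  have hxlim : Tendsto (fun n => (γ n t).re) atTop (nhds p₁.re) := by
    have h := hsq.sqrt
    simp only [Real.sqrt_sq_eq_abs, Real.sqrt_zero] at h
    have h' := (tendsto_zero_iff_abs_tendsto_zero _).2 h
    simpa using h'.add_const p₁.re
  have hfin := ((Complex.continuous_ofReal.tendsto _).comp hxlim).add
    (((Complex.continuous_ofReal.tendsto _).comp hylim).mul_const Complex.I)
  rw [Complex.ofReal_mul] at hfin
  refine hfin.congr (fun n => ?_)
  exact Complex.re_add_im (γ n t : ℂ)
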